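/- Let n be a nonnegative integer and let a, c ∈ ℂ satisfy a ≠ 1/2, c + j ≠ 0 for 0 ≤ j ≤ n−1, c ≠ 0 in case n = 0 is excluded automatically (only (c)_n ≠ 0 is needed), and 1−c−n+j ≠ 0 for 0 ≤ j ≤ ⌊n/2⌋−1. Then Σ_{k=0}^{⌊n/2⌋} (−n/2)_k ((1−n)/2)_k (a)_k (1−a)_k / ((3/2)_k (c)_k (1−c−n)_k · k!) = ((c−a)_{n+1} − (c+a−1)_{n+1}) / ((n+1)(1−2a)(c)_n). (Terminating balanced ₄F₃-series identity obtained from the first Chu–Vandermonde–Gauß reciprocal relation by replacing a by 1−a and shifting n to n+1.) -/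

import Mathlib

/-- Rising factorial (Pochhammer symbol) of a complex number:
`poch x 0 = 1` and `poch x (m+1) = poch x m * (x + m)`. -/
noncomputable def poch (x : ℂ) : ℕ → ℂ
  | 0 => 1
  | m + 1 => poch x m * (x + (m : ℂ))

theorem poch_succ (x : ℂ) (m : ℕ) : poch x (m + 1) = poch x m * (x + (m : ℂ)) := rfl

theorem poch_zero (x : ℂ) : poch x 0 = 1 := rfl

theorem poch_succ_left (x : ℂ) (m : ℕ) : poch x (m + 1) = x * poch (x + 1) m := by
  induction m with
  | zero => simp [poch]
  | succ m ih =>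
    rw [poch_succ, ih, poch_succ]
    push_cast
    ring

theorem poch_add (x : ℂ) (i j : ℕ) : poch x (i + j) = poch x i * poch (x + i) j := by
  induction j with
  | zero => simp [poch]
  | succ j ih =>
    rw [← add_assoc, poch_succ, ih, poch_succ]
    push_cast
    ring

theorem poch_reflect (x : ℂ) (k : ℕ) : poch (1 - x - k) k = (-1) ^ k * poch x k := by
  induction k with
  | zero => simp [poch]
  | succ k ih =>
    rw [poch_succ_left, poch_succ x]
    have : (1 - x - ((k + 1 : ℕ) : ℂ) + 1) = 1 - x - k := by push_cast; ring
    rw [this, ih]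
    push_cast
    ring

theorem poch_ne_zero (x : ℂ) (n : ℕ) (h : ∀ j : ℕ, j < n → x + (j : ℂ) ≠ 0) : poch x n ≠ 0 := by
  induction n with
  | zero => simp [poch]
  | succ n ih =>
    rw [poch_succ]
    exact mul_ne_zero (ih fun j hj => h j (by omega)) (h n (by omega))

theorem choose_step (n k : ℕ) :
    (n.choose (k + 1) : ℂ) * ((k : ℂ) + 1) = n.choose k * ((n : ℂ) - k) := by
  rcases le_or_gt k n with h | h
  · have := Nat.choose_succ_right_eq n k
    rw [← Nat.cast_sub h]
    exact_mod_cast this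
  · rw [Nat.choose_eq_zero_of_lt h, Nat.choose_eq_zero_of_lt (by omega : n < k + 1)]
    simp

/-- Summand of the polynomial form of the identity. -/
noncomputable def tt (a : ℂ) (N k : ℕ) (c : ℂ) : ℂ :=
  (N.choose (2 * k + 1) : ℂ) * ((-1) ^ k * (poch a k * poch (1 - a) k)) *
    poch (c + k) (N - 1 - 2 * k)

/-- Telescoping part. -/
noncomputable def ww (a : ℂ) (N : ℕ) (c : ℂ) : ℕ → ℂ
  | 0 => 0
  | k + 1 => (N.choose (2 * k + 1) : ℂ) * ((-1) ^ (k + 1) * (poch a (k + 1) * poch (1 - a) (k + 1)))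
      * poch (c + k + 1) (N - 1 - 2 * k)

theorem coef_zero (N : ℕ) (c : ℂ) :
    ((N + 2).choose 1 : ℂ) * (c + N) = (2 * c + N) * (N + 1).choose 1 - N.choose 1 * (c - 1) := by
  simp only [Nat.choose_one_right]
  push_cast
  ring

theorem coef_succ (N k : ℕ) (c : ℂ) :
    ((N + 2).choose (2 * k + 3) : ℂ) * (c + N - (k + 1)) =
      (2 * c + N) * (N + 1).choose (2 * k + 3) - N.choose (2 * k + 3) * (c - k - 2)
        + N.choose (2 * k + 1) * (c + N - (k + 1)) := by
  have h1 : (N + 2).choose (2 * k + 3) =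
      N.choose (2 * k + 1) + 2 * N.choose (2 * k + 2) + N.choose (2 * k + 3) := by
    rw [Nat.choose_succ_succ' (N + 1) (2 * k + 2), Nat.choose_succ_succ' N (2 * k + 1),
      Nat.choose_succ_succ' N (2 * k + 2)]
    ring
  have h2 : (N + 1).choose (2 * k + 3) = N.choose (2 * k + 2) + N.choose (2 * k + 3) :=
    Nat.choose_succ_succ' N (2 * k + 2)
  have h3 := choose_step N (2 * k + 2)
  rw [h1, h2]
  push_cast at h3 ⊢
  linear_combination (-1 : ℂ) * h3

theorem pq_step (a c : ℂ) (N k : ℕ) :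
    (c - a) * (c + a - 1) * tt a N k (c + 1) + ww a N c (k + 1) =
      (N.choose (2 * k + 1) : ℂ) * (c - k - 1) * ((-1) ^ k * (poch a k * poch (1 - a) k)) *
        poch (c + k) (N - 2 * k) := by
  rcases lt_or_ge N (2 * k + 1) with h | h
  · simp [tt, ww, Nat.choose_eq_zero_of_lt h]
  · obtain ⟨m, rfl⟩ := Nat.exists_eq_add_of_le h
    have e1 : 2 * k + 1 + m - 1 - 2 * k = m := by omega
    have e2 : 2 * k + 1 + m - 2 * k = m + 1 := by omega
    have e3 : c + 1 + (k : ℂ) = c + k + 1 := by ring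
    simp only [tt, ww, e1, e2, e3, poch_succ_left (c + k) m, poch_succ a, poch_succ (1 - a)]
    ring

theorem tt_step (a c : ℂ) (N k : ℕ) :
    tt a (N + 2) k c = (2 * c + N) * tt a (N + 1) k c
      - (c - a) * (c + a - 1) * tt a N k (c + 1) - (ww a N c (k + 1) - ww a N c k) := by
  have h := pq_step a c N k
  suffices H : tt a (N + 2) k c = (2 * c + N) * tt a (N + 1) k c
      - (N.choose (2 * k + 1) : ℂ) * (c - k - 1) * ((-1) ^ k * (poch a k * poch (1 - a) k)) *
        poch (c + k) (N - 2 * k) + ww a N c k by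
    rw [H]; linear_combination h
  rcases le_or_gt (2 * k) N with hk | hk
  · obtain ⟨m, hm⟩ := Nat.exists_eq_add_of_le hk
    have e1 : N + 2 - 1 - 2 * k = m + 1 := by omega
    have e2 : N + 1 - 1 - 2 * k = m := by omega
    have e3 : N - 2 * k = m := by omega
    have e4 : (m : ℂ) = N - 2 * k := by rw [hm]; push_cast; ring
    simp only [tt, e1, e2, e3, poch_succ (c + k) m, e4]
    cases k with
    | zero =>
      have := coef_zero N c
      simp only [ww, poch_zero]
      simp only [Nat.mul_zero, Nat.zero_add, Nat.cast_zero] at this ⊢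
      linear_combination (poch (c + 0) m) * this
    | succ k =>
      have := coef_succ N k c
      have e5 : N - 1 - 2 * k = m + 1 := by omega
      have e6 : 2 * (k + 1) + 1 = 2 * k + 3 := by ring
      have e7 : c + (k : ℂ) + 1 = c + ((k + 1 : ℕ) : ℂ) := by push_cast; ring
      simp only [ww, e5, e6, e7, poch_succ _ m, e4]
      generalize poch a (k + 1) * poch (1 - a) (k + 1) = A
      generalize poch (c + ((k + 1 : ℕ) : ℂ)) m = B
      push_cast
      linear_combination ((-1) ^ (k + 1) * A * B) * this
  · obtain ⟨k, rfl⟩ : ∃ j, k = j + 1 := ⟨k - 1, by omega⟩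
    have z1 : N.choose (2 * (k + 1) + 1) = 0 := Nat.choose_eq_zero_of_lt (by omega)
    have z2 : (N + 1).choose (2 * (k + 1) + 1) = 0 := Nat.choose_eq_zero_of_lt (by omega)
    simp only [tt, ww, z1, z2]
    rcases lt_or_ge N (2 * k + 1) with h' | h'
    · have z3 : N.choose (2 * k + 1) = 0 := Nat.choose_eq_zero_of_lt h'
      have z4 : (N + 2).choose (2 * (k + 1) + 1) = 0 := Nat.choose_eq_zero_of_lt (by omega)
      simp [z3, z4]
    · have hN : N = 2 * k + 1 := by omega
      subst hN
      have e1 : 2 * k + 1 + 2 - 1 - 2 * (k + 1) = 0 := by omega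
      have e2 : 2 * k + 1 - 1 - 2 * k = 0 := by omega
      have e3 : 2 * (k + 1) + 1 = 2 * k + 1 + 2 := by ring
      simp only [e1, e2, e3, poch_zero, Nat.choose_self]
      push_cast
      ring

theorem poch_two (x : ℂ) (c : ℂ) (N : ℕ) (y : ℂ) (hxy : x + y = 2 * c - 1) :
    poch x (N + 2) = (2 * c + N) * poch x (N + 1) - x * y * poch (x + 1) N := by
  rw [poch_succ x (N + 1), poch_succ_left x N]
  have : y = 2 * c - 1 - x := by rw [← hxy]; ring
  rw [this]
  push_cast
  ring

theorem sum_tt (a : ℂ) (N : ℕ) : ∀ (c : ℂ) (M : ℕ), N ≤ 2 * M →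
    (1 - 2 * a) * ∑ k ∈ Finset.range M, tt a N k c = poch (c - a) N - poch (c + a - 1) N := by
  induction N using Nat.strong_induction_on with
  | _ N ih =>
    intro c M hM
    match N, ih, hM with
    | 0, _, _ => simp [tt, poch]
    | 1, _, hM =>
      obtain ⟨M, rfl⟩ : ∃ j, M = j + 1 := ⟨M - 1, by omega⟩
      rw [Finset.sum_range_succ', Finset.sum_eq_zero]
      · simp [tt, poch]
        ring
      · intro k _
        have : Nat.choose 1 (2 * (k + 1) + 1) = 0 := Nat.choose_eq_zero_of_lt (by omega)
        simp [tt, this]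
    | N + 2, ih, hM =>
      have h1 := ih (N + 1) (by omega) c M (by omega)
      have h0 := ih N (by omega) (c + 1) M (by omega)
      rw [Finset.sum_congr rfl fun k _ => tt_step a c N k, Finset.sum_sub_distrib,
        Finset.sum_sub_distrib, Finset.sum_range_sub, ← Finset.mul_sum, ← Finset.mul_sum]
      have hw : ww a N c M = 0 := by
        obtain ⟨M, rfl⟩ : ∃ j, M = j + 1 := ⟨M - 1, by omega⟩
        have : N.choose (2 * M + 1) = 0 := Nat.choose_eq_zero_of_lt (by omega)
        simp [ww, this]
      have hw0 : ww a N c 0 = 0 := rfl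
      rw [hw, hw0, poch_two (c - a) c N (c + a - 1) (by ring),
        poch_two (c + a - 1) c N (c - a) (by ring)]
      rw [show c + 1 - a = c - a + 1 by ring, show c + 1 + a - 1 = c + a - 1 + 1 by ring] at h0
      linear_combination (2 * c + N) * h1 - (c - a) * (c + a - 1) * h0

theorem num_eq (n k : ℕ) :
    poch (-(n : ℂ) / 2) k * poch ((1 - (n : ℂ)) / 2) k * ((n : ℂ) + 1) =
      ((n + 1).choose (2 * k + 1) : ℂ) * (poch (3 / 2) k * (Nat.factorial k : ℂ)) := by
  induction k with
  | zero => simp [poch]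
  | succ k ih =>
    have h1 := choose_step (n + 1) (2 * k + 1)
    have h2 := choose_step (n + 1) (2 * k + 2)
    rw [show 2 * (k + 1) + 1 = 2 * k + 2 + 1 by ring]
    rw [show 2 * k + 1 + 1 = 2 * k + 2 by ring] at h1
    simp only [poch_succ, Nat.factorial_succ]
    push_cast at h1 h2 ⊢
    linear_combination (-(n : ℂ) / 2 + k) * ((1 - (n : ℂ)) / 2 + k) * ih
      - (poch (3 / 2) k * (Nat.factorial k : ℂ)) * ((k + 1) / 2 * h2 + (n - 1 - 2 * k) / 4 * h1)

theorem den_eq (n k : ℕ) (c : ℂ) (h : 2 * k ≤ n) :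
    poch c n = poch c k * poch (1 - c - n) k * ((-1) ^ k * poch (c + k) (n - 2 * k)) := by
  obtain ⟨m, rfl⟩ := Nat.exists_eq_add_of_le h
  have e1 : 2 * k + m - 2 * k = m := by omega
  have e2 : 1 - c - ((2 * k + m : ℕ) : ℂ) = 1 - (c + k + m) - k := by push_cast; ring
  rw [e1, e2, poch_reflect, show 2 * k + m = k + m + k by ring, poch_add, poch_add]
  push_cast
  rw [← add_assoc]
  have : ((-1 : ℂ) ^ k) * (-1) ^ k = 1 := by rw [← mul_pow]; simp
  linear_combination (-(poch c k * poch (c + k) m * poch (c + k + m) k)) * this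

theorem three_half_ne (k : ℕ) : poch (3 / 2) k ≠ 0 := by
  apply poch_ne_zero
  intro j _ h
  have h2 : ((3 + 2 * j : ℕ) : ℂ) = 0 := by push_cast; linear_combination 2 * h
  have h3 : 3 + 2 * j = 0 := by exact_mod_cast h2
  omega

/-- Terminating balanced ₄F₃-series identity from the first CVG reciprocal relation. -/
theorem cvg_balanced_4F3 (n : ℕ) (a c : ℂ)
    (ha : a ≠ 1 / 2)
    (hc : ∀ j : ℕ, j < n → c + (j : ℂ) ≠ 0)
    (hcn : ∀ j : ℕ, j < n / 2 → 1 - c - (n : ℂ) + (j : ℂ) ≠ 0) :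
    ∑ k ∈ Finset.range (n / 2 + 1),
      poch (-(n : ℂ) / 2) k * poch ((1 - (n : ℂ)) / 2) k * poch a k * poch (1 - a) k /
        (poch (3 / 2) k * poch c k * poch (1 - c - (n : ℂ)) k * (Nat.factorial k : ℂ)) =
      (poch (c - a) (n + 1) - poch (c + a - 1) (n + 1)) /
        (((n : ℂ) + 1) * (1 - 2 * a) * poch c n) := by
  have hcn0 : poch c n ≠ 0 := poch_ne_zero c n hc
  have hn : (n : ℂ) + 1 ≠ 0 := Nat.cast_add_one_ne_zero n
  have ha' : 1 - 2 * a ≠ 0 := fun h => ha (by linear_combination (-1 / 2 : ℂ) * h)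
  have hS := sum_tt a (n + 1) c (n / 2 + 1) (by omega)
  rw [← hS, mul_comm (1 - 2 * a), mul_right_comm, mul_div_mul_right _ _ ha', Finset.sum_div]
  refine Finset.sum_congr rfl fun k hk => ?_
  have hk2 : 2 * k ≤ n := by have := Finset.mem_range.1 hk; omega
  have hd := den_eq n k c hk2
  have hnum := num_eq n k
  have h32 := three_half_ne k
  have hf : (Nat.factorial k : ℂ) ≠ 0 := Nat.cast_ne_zero.2 (Nat.factorial_ne_zero k)
  have hprod := hcn0
  rw [hd] at hprod
  have hp1 := left_ne_zero_of_mul (left_ne_zero_of_mul hprod)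
  have hp2 := right_ne_zero_of_mul (left_ne_zero_of_mul hprod)
  rw [div_eq_div_iff (mul_ne_zero (mul_ne_zero (mul_ne_zero h32 hp1) hp2) hf)
    (mul_ne_zero hn hcn0)]
  simp only [tt, Nat.add_sub_cancel]
  rw [hd]
  linear_combination (poch a k * poch (1 - a) k *
    (poch c k * poch (1 - c - n) k * ((-1) ^ k * poch (c + k) (n - 2 * k)))) * hnum
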